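/- Let d ≥ 1 be an integer, 1 < p < ∞, m a nonnegative integer with m > d/p, δ ∈ ℝ, and let α be a multi-index with |α| < m − d/p. Then there exists a constant C > 0 such that for every f ∈ C_c^∞(ℝ^d) and every x ∈ ℝ^d one has ⟨x⟩^{δ + d/p + |α|} |∂^α f(x)| ≤ C ‖f‖_{W^{m,p}_δ}. -/

import Mathlib

open MeasureTheory

/-- Partial derivative in direction `j`. -/
noncomputable def pd {d : ℕ} (j : Fin d) (f : (Fin d → ℝ) → ℝ) : (Fin d → ℝ) → ℝ :=
  fun x => fderiv ℝ f x (Pi.single j 1)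

/-- Iterated partial derivative `∂^α`. -/
noncomputable def pdm {d : ℕ} (α : Fin d → ℕ) (f : (Fin d → ℝ) → ℝ) : (Fin d → ℝ) → ℝ :=
  (List.finRange d).foldr (fun j g => (pd j)^[α j] g) f

/-- Japanese bracket `⟨x⟩ = (1+|x|²)^{1/2}` with the Euclidean norm. -/
noncomputable def jap {d : ℕ} (x : Fin d → ℝ) : ℝ := Real.sqrt (1 + ∑ i, x i ^ 2)

/-- The weighted Sobolev norm `‖f‖_{W^{m,p}_δ}`. -/
noncomputable def wnorm (d m : ℕ) (p δ : ℝ) (f : (Fin d → ℝ) → ℝ) : ℝ :=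
  ∑ β : Fin d → Fin (m + 1),
    if (∑ j, (β j : ℕ)) ≤ m then
      (∫ x : Fin d → ℝ,
        jap x ^ ((δ + ((∑ j, (β j : ℕ)) : ℝ)) * p) *
          |pdm (fun j => (β j : ℕ)) f x| ^ p) ^ (1 / p)
    else 0

theorem aux_pd_smooth {d : ℕ} (j : Fin d) {f : (Fin d → ℝ) → ℝ}
    (hf : ContDiff ℝ (⊤ : ℕ∞) f) : ContDiff ℝ (⊤ : ℕ∞) (pd j f) := by
  unfold pd
  exact (hf.fderiv_right (m := ((⊤ : ℕ∞) : WithTop ℕ∞)) (by simp)).clm_apply contDiff_const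

theorem aux_pd_comm {d : ℕ} (i j : Fin d) {f : (Fin d → ℝ) → ℝ}
    (hf : ContDiff ℝ (⊤ : ℕ∞) f) : pd i (pd j f) = pd j (pd i f) := by
  have hD : Differentiable ℝ (fderiv ℝ f) :=
    (hf.fderiv_right (m := ((⊤ : ℕ∞) : WithTop ℕ∞)) (by simp)).differentiable (by simp)
  have key : ∀ a b : Fin d, ∀ x, pd a (pd b f) x
      = (fderiv ℝ (fderiv ℝ f) x (Pi.single a 1)) (Pi.single b 1) := by
    intro a b x
    unfold pd
    rw [fderiv_clm_apply (hD x) (differentiableAt_const _)]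
    simp
  funext x
  rw [key, key]
  have hs : IsSymmSndFDerivAt ℝ f x := by
    apply (hf.contDiffAt (x := x)).isSymmSndFDerivAt
    rw [minSmoothness_of_isRCLikeNormedField]
    exact WithTop.coe_le_coe.2 (le_top : (2 : ℕ∞) ≤ ⊤)
  exact hs.eq _ _

theorem aux_pdit_smooth {d : ℕ} (j : Fin d) (n : ℕ) {f : (Fin d → ℝ) → ℝ}
    (hf : ContDiff ℝ (⊤ : ℕ∞) f) : ContDiff ℝ (⊤ : ℕ∞) ((pd j)^[n] f) := by
  induction n with
  | zero => simpa using hf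
  | succ n ih => rw [Function.iterate_succ_apply']; exact aux_pd_smooth j ih

theorem aux_pdit_comm {d : ℕ} (i j : Fin d) (n : ℕ) {f : (Fin d → ℝ) → ℝ}
    (hf : ContDiff ℝ (⊤ : ℕ∞) f) : pd i ((pd j)^[n] f) = (pd j)^[n] (pd i f) := by
  induction n with
  | zero => simp
  | succ n ih =>
    rw [Function.iterate_succ_apply', Function.iterate_succ_apply',
      aux_pd_comm i j (aux_pdit_smooth j n hf), ih]

theorem aux_fold_smooth {d : ℕ} (l : List (Fin d)) (α : Fin d → ℕ) {f : (Fin d → ℝ) → ℝ}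
    (hf : ContDiff ℝ (⊤ : ℕ∞) f) :
    ContDiff ℝ (⊤ : ℕ∞) (l.foldr (fun j g => (pd j)^[α j] g) f) := by
  induction l with
  | nil => simpa using hf
  | cons a l ih => simp only [List.foldr_cons]; exact aux_pdit_smooth a _ ih

theorem aux_pdm_smooth {d : ℕ} (α : Fin d → ℕ) {f : (Fin d → ℝ) → ℝ}
    (hf : ContDiff ℝ (⊤ : ℕ∞) f) : ContDiff ℝ (⊤ : ℕ∞) (pdm α f) :=
  aux_fold_smooth _ α hf

theorem aux_pdm_supp {d : ℕ} (α : Fin d → ℕ) {f : (Fin d → ℝ) → ℝ}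
    (hf : HasCompactSupport f) : HasCompactSupport (pdm α f) := by
  unfold pdm
  induction (List.finRange d) with
  | nil => simpa using hf
  | cons a l ih =>
    simp only [List.foldr_cons]
    generalize α a = n
    induction n with
    | zero => simpa using ih
    | succ n ih2 =>
      rw [Function.iterate_succ_apply']
      exact ih2.fderiv_apply ℝ _

theorem aux_fold_congr {d : ℕ} (l : List (Fin d)) (α β : Fin d → ℕ) (f : (Fin d → ℝ) → ℝ)
    (h : ∀ j ∈ l, α j = β j) :
    l.foldr (fun j g => (pd j)^[α j] g) f = l.foldr (fun j g => (pd j)^[β j] g) f := by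
  induction l with
  | nil => rfl
  | cons a l ih =>
    simp only [List.foldr_cons]
    rw [ih (fun j hj => h j (List.mem_cons_of_mem _ hj)), h a (by simp)]

theorem aux_fold_pd {d : ℕ} (l : List (Fin d)) (hl : l.Nodup) (i : Fin d) (hi : i ∈ l)
    (α : Fin d → ℕ) {f : (Fin d → ℝ) → ℝ} (hf : ContDiff ℝ (⊤ : ℕ∞) f) :
    pd i (l.foldr (fun j g => (pd j)^[α j] g) f)
      = l.foldr (fun j g => (pd j)^[(α + Pi.single i 1 : Fin d → ℕ) j] g) f := by
  induction l with
  | nil => simp at hi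
  | cons a l ih =>
    rw [List.nodup_cons] at hl
    simp only [List.foldr_cons]
    by_cases h : i = a
    · subst h
      rw [← aux_fold_congr l α (α + Pi.single i 1) f]
      · rw [← Function.iterate_succ_apply' (pd i)]
        simp
      · intro j hj
        have : j ≠ i := fun h => hl.1 (h ▸ hj)
        simp [this]
    · have hi' : i ∈ l := by
        rcases List.mem_cons.1 hi with h' | h'
        · exact absurd h' h
        · exact h'
      rw [aux_pdit_comm i a _ (aux_fold_smooth l α hf), ih hl.2 hi']
      have : a ≠ i := fun h' => h h'.symm
      simp [this]

theorem aux_pd_pdm {d : ℕ} (i : Fin d) (α : Fin d → ℕ) {f : (Fin d → ℝ) → ℝ}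
    (hf : ContDiff ℝ (⊤ : ℕ∞) f) : pd i (pdm α f) = pdm (α + Pi.single i 1) f :=
  aux_fold_pd _ (List.nodup_finRange d) i (List.mem_finRange i) α hf

/-- Directional derivative. -/
noncomputable def auxT {d : ℕ} (w : Fin d → ℝ) (f : (Fin d → ℝ) → ℝ) : (Fin d → ℝ) → ℝ :=
  fun x => fderiv ℝ f x w

theorem auxT_smooth {d : ℕ} (w : Fin d → ℝ) {f : (Fin d → ℝ) → ℝ}
    (hf : ContDiff ℝ (⊤ : ℕ∞) f) : ContDiff ℝ (⊤ : ℕ∞) (auxT w f) := by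
  unfold auxT
  exact (hf.fderiv_right (m := ((⊤ : ℕ∞) : WithTop ℕ∞)) (by simp)).clm_apply contDiff_const

theorem auxT_it_smooth {d : ℕ} (w : Fin d → ℝ) (n : ℕ) {f : (Fin d → ℝ) → ℝ}
    (hf : ContDiff ℝ (⊤ : ℕ∞) f) : ContDiff ℝ (⊤ : ℕ∞) ((auxT w)^[n] f) := by
  induction n with
  | zero => simpa using hf
  | succ n ih => rw [Function.iterate_succ_apply']; exact auxT_smooth w ih

theorem auxT_sum {d : ℕ} (w c : Fin d → ℝ) (F : Fin d → (Fin d → ℝ) → ℝ)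
    (hF : ∀ i, ContDiff ℝ (⊤ : ℕ∞) (F i)) :
    auxT w (fun x => ∑ i, c i * F i x) = fun x => ∑ i, c i * auxT w (F i) x := by
  funext x
  unfold auxT
  have hd : ∀ i, DifferentiableAt ℝ (F i) x := fun i => (hF i).differentiable (by simp) x
  rw [fderiv_fun_sum (fun i _ => (hd i).const_mul (c i))]
  simp only [sum_apply]
  refine Finset.sum_congr rfl fun i _ => ?_
  rw [fderiv_const_mul (hd i)]
  simp

theorem auxT_it_sum {d : ℕ} (w c : Fin d → ℝ) (n : ℕ) (F : Fin d → (Fin d → ℝ) → ℝ)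
    (hF : ∀ i, ContDiff ℝ (⊤ : ℕ∞) (F i)) :
    (auxT w)^[n] (fun x => ∑ i, c i * F i x) = fun x => ∑ i, c i * (auxT w)^[n] (F i) x := by
  induction n with
  | zero => rfl
  | succ n ih =>
    rw [Function.iterate_succ_apply', ih, auxT_sum w c _ (fun i => auxT_it_smooth w n (hF i))]
    simp only [Function.iterate_succ_apply']

theorem auxT_eq {d : ℕ} (w : Fin d → ℝ) (f : (Fin d → ℝ) → ℝ) :
    auxT w f = fun x => ∑ i, w i * pd i f x := by
  funext x
  unfold auxT pd
  conv_lhs => rw [pi_eq_sum_univ' w]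
  rw [map_sum]
  refine Finset.sum_congr rfl fun i _ => ?_
  rw [map_smul, smul_eq_mul]

/-- Sum of absolute values of derivatives of order `n`. -/
noncomputable def auxM (d m n : ℕ) (f : (Fin d → ℝ) → ℝ) (z : Fin d → ℝ) : ℝ :=
  ∑ β : Fin d → Fin (m + 1),
    if (∑ j, (β j : ℕ)) = n then |pdm (fun j => (β j : ℕ)) f z| else 0

theorem auxM_ge {d m : ℕ} (α : Fin d → ℕ) (h : ∑ j, α j ≤ m) (f : (Fin d → ℝ) → ℝ)
    (z : Fin d → ℝ) : |pdm α f z| ≤ auxM d m (∑ j, α j) f z := by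
  have hle : ∀ j, α j < m + 1 := fun j =>
    Nat.lt_succ_of_le ((Finset.single_le_sum (fun i _ => Nat.zero_le (α i))
      (Finset.mem_univ j)).trans h)
  unfold auxM
  refine le_trans ?_ (Finset.single_le_sum (f := fun β : Fin d → Fin (m+1) =>
    if (∑ j, (β j : ℕ)) = ∑ j, α j then |pdm (fun j => (β j : ℕ)) f z| else 0) ?_
    (Finset.mem_univ (fun j => (⟨α j, hle j⟩ : Fin (m+1)))))
  · simp
  · intro β _
    split_ifs <;> positivity

theorem auxM_nonneg {d m n : ℕ} (f : (Fin d → ℝ) → ℝ)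
    (z : Fin d → ℝ) : 0 ≤ auxM d m n f z := by
  unfold auxM
  refine Finset.sum_nonneg fun β _ => ?_
  split_ifs <;> positivity

theorem auxM_cont {d m n : ℕ} {f : (Fin d → ℝ) → ℝ} (hf : ContDiff ℝ (⊤ : ℕ∞) f) :
    Continuous (auxM d m n f) := by
  unfold auxM
  refine continuous_finsetSum _ fun β _ => ?_
  split_ifs
  · exact (aux_pdm_smooth _ hf).continuous.abs
  · exact continuous_const

theorem auxT_bound {d m : ℕ} (w : Fin d → ℝ) (R : ℝ) (hw : ∀ i, |w i| ≤ R)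
    {f : (Fin d → ℝ) → ℝ} (hf : ContDiff ℝ (⊤ : ℕ∞) f) (j : ℕ) (hR : 0 ≤ R)
    (z : Fin d → ℝ) : ∀ (α : Fin d → ℕ), (∑ i, α i) + j ≤ m →
    |(auxT w)^[j] (pdm α f) z| ≤ (d * R) ^ j * auxM d m ((∑ i, α i) + j) f z := by
  induction j with
  | zero => intro α h; simpa using auxM_ge α h f z
  | succ j ih =>
    intro α h
    rw [Function.iterate_succ_apply, auxT_eq, auxT_it_sum w w j _
      (fun i => aux_pd_smooth i (aux_pdm_smooth α hf))]
    simp only [aux_pd_pdm _ α hf]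
    have hs : ∀ i, ∑ k, (α + Pi.single i 1 : Fin d → ℕ) k = (∑ k, α k) + 1 := by
      intro i
      simp [Finset.sum_add_distrib]
    calc _ ≤ ∑ i, |w i * (auxT w)^[j] (pdm (α + Pi.single i 1) f) z| :=
          Finset.abs_sum_le_sum_abs _ _
      _ ≤ ∑ i : Fin d, R * ((d * R) ^ j * auxM d m ((∑ i, α i) + (j + 1)) f z) := by
          refine Finset.sum_le_sum fun i _ => ?_
          rw [abs_mul]
          have := ih (α + Pi.single i 1) (by rw [hs]; omega)
          rw [hs] at this
          rw [show (∑ i, α i) + (j + 1) = (∑ i, α i) + 1 + j by ring]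
          exact mul_le_mul (hw i) this (abs_nonneg _) hR
      _ = _ := by
          simp; ring

theorem aux_taylor (φ : ℕ → ℝ → ℝ) (h : ∀ j s, HasDerivAt (φ j) (φ (j + 1) s) s) (k : ℕ) :
    |φ 0 0| ≤ ∑ j ∈ Finset.range (k + 1), |φ j 1| + ∫ s in (0 : ℝ)..1, s ^ k * |φ (k + 1) s| := by
  have hc : ∀ j, Continuous (φ j) := fun j =>
    continuous_iff_continuousAt.2 fun s => (h j s).continuousAt
  have main : ∀ k : ℕ, |φ 0 0| ≤ ∑ j ∈ Finset.range (k + 1), |φ j 1|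
      + |∫ s in (0 : ℝ)..1, s ^ k * φ (k + 1) s| := by
    intro k
    induction k with
    | zero =>
      have : ∫ s in (0 : ℝ)..1, φ 1 s = φ 0 1 - φ 0 0 :=
        intervalIntegral.integral_eq_sub_of_hasDerivAt (fun s _ => h 0 s)
          ((hc 1).intervalIntegrable _ _)
      simp only [zero_add, Finset.range_one, Finset.sum_singleton, pow_zero, one_mul, this]
      have := abs_sub (φ 0 1) (φ 0 1 - φ 0 0)
      simpa using this
    | succ k ih =>
      refine ih.trans ?_
      rw [Finset.sum_range_succ _ (k + 1), add_assoc]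
      gcongr
      have ibp := intervalIntegral.integral_mul_deriv_eq_deriv_mul (a := 0) (b := 1)
        (u := φ (k + 1)) (v := fun s => s ^ (k + 1) / ((k : ℝ) + 1)) (u' := φ (k + 2))
        (v' := fun s => s ^ k)
        (fun s _ => h (k + 1) s)
        (fun s _ => by
          have := (hasDerivAt_pow (k + 1) s).div_const ((k : ℝ) + 1)
          have hk : (k : ℝ) + 1 ≠ 0 := by positivity
          convert this using 1
          push_cast
          try simp only [Nat.add_sub_cancel]
          field_simp)
        ((hc (k + 2)).intervalIntegrable _ _)
        ((continuous_pow k).intervalIntegrable _ _)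
      have e1 : ∫ s in (0 : ℝ)..1, s ^ k * φ (k + 1) s
          = ∫ s in (0 : ℝ)..1, φ (k + 1) s * s ^ k := by
        congr 1; funext s; ring
      have e2 : ∫ s in (0 : ℝ)..1, φ (k + 2) s * (s ^ (k + 1) / ((k : ℝ) + 1))
          = (∫ s in (0 : ℝ)..1, s ^ (k + 1) * φ (k + 2) s) / ((k : ℝ) + 1) := by
        rw [← intervalIntegral.integral_div]
        congr 1; funext s; ring
      rw [e1, ibp, e2]
      simp only [one_pow, ne_eq, Nat.add_eq_zero_iff, one_ne_zero, and_false, not_false_eq_true,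
        zero_pow, zero_div, mul_zero, sub_zero]
      set I := ∫ s in (0 : ℝ)..1, s ^ (k + 1) * φ (k + 2) s
      have hk1 : (1 : ℝ) ≤ (k : ℝ) + 1 := by
        have : (0 : ℝ) ≤ k := Nat.cast_nonneg k
        linarith
      have hk0 : (0 : ℝ) < (k : ℝ) + 1 := by linarith
      refine (abs_sub _ _).trans ?_
      rw [abs_mul, abs_div, abs_div, abs_of_pos hk0, abs_one]
      have h1 : 1 / ((k : ℝ) + 1) ≤ 1 := (div_le_one hk0).2 hk1
      exact add_le_add (mul_le_of_le_one_right (abs_nonneg _) h1) (div_le_self (abs_nonneg _) hk1)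
  refine (main k).trans ?_
  gcongr
  refine (intervalIntegral.abs_integral_le_integral_abs (by norm_num)).trans (le_of_eq ?_)
  refine intervalIntegral.integral_congr fun s hs => ?_
  rw [Set.uIcc_of_le (by norm_num)] at hs
  simp only [abs_mul, abs_pow, abs_of_nonneg hs.1]

theorem aux_jap_pos {d : ℕ} (x : Fin d → ℝ) : 1 ≤ jap x := by
  unfold jap
  rw [Real.one_le_sqrt]
  have : 0 ≤ ∑ i, x i ^ 2 := Finset.sum_nonneg fun i _ => sq_nonneg _
  linarith

theorem aux_jap_sq {d : ℕ} (x : Fin d → ℝ) : jap x ^ 2 = 1 + ∑ i, x i ^ 2 := by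
  unfold jap
  have : 0 ≤ ∑ i, x i ^ 2 := Finset.sum_nonneg fun i _ => sq_nonneg _
  exact Real.sq_sqrt (by linarith)

theorem aux_jap_cont {d : ℕ} : Continuous (jap : (Fin d → ℝ) → ℝ) := by
  unfold jap
  fun_prop

theorem aux_jap_cmp {d : ℕ} (hd : 1 ≤ d) (x z : Fin d → ℝ)
    (h : ∀ i, |z i - x i| ≤ jap x / (2 * d)) : jap z ≤ 2 * jap x ∧ jap x ≤ 2 * jap z := by
  have hd' : (1 : ℝ) ≤ d := by exact_mod_cast hd
  have hx := aux_jap_pos x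
  have hz := aux_jap_pos z
  have hS : ∑ i, (z i - x i) ^ 2 ≤ jap x ^ 2 / 4 := by
    calc ∑ i, (z i - x i) ^ 2 ≤ ∑ i : Fin d, (jap x / (2 * d)) ^ 2 := by
          refine Finset.sum_le_sum fun i _ => ?_
          rw [← sq_abs]
          exact pow_le_pow_left₀ (abs_nonneg _) (h i) 2
      _ = jap x ^ 2 / 4 / d := by
          simp; field_simp; ring
      _ ≤ _ := div_le_self (by positivity) hd'
  have a1 : ∑ i, z i ^ 2 ≤ 2 * ∑ i, x i ^ 2 + 2 * ∑ i, (z i - x i) ^ 2 := by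
    rw [Finset.mul_sum, Finset.mul_sum, ← Finset.sum_add_distrib]
    exact Finset.sum_le_sum fun i _ => by nlinarith [sq_nonneg (z i - 2 * x i)]
  have a2 : ∑ i, x i ^ 2 ≤ 2 * ∑ i, z i ^ 2 + 2 * ∑ i, (z i - x i) ^ 2 := by
    rw [Finset.mul_sum, Finset.mul_sum, ← Finset.sum_add_distrib]
    exact Finset.sum_le_sum fun i _ => by nlinarith [sq_nonneg (x i - 2 * z i)]
  have jx := aux_jap_sq x
  have jz := aux_jap_sq z
  constructor
  · apply le_of_sq_le_sq _ (by linarith)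
    nlinarith
  · apply le_of_sq_le_sq _ (by linarith)
    nlinarith

theorem aux_jap_rpow {d : ℕ} (hd : 1 ≤ d) (x z : Fin d → ℝ)
    (h : ∀ i, |z i - x i| ≤ jap x / (2 * d)) (γ : ℝ) :
    jap x ^ γ ≤ 2 ^ |γ| * jap z ^ γ := by
  obtain ⟨h1, h2⟩ := aux_jap_cmp hd x z h
  have hx : 0 < jap x := by linarith [aux_jap_pos x]
  have hz : 0 < jap z := by linarith [aux_jap_pos z]
  rcases le_total 0 γ with hg | hg
  · rw [abs_of_nonneg hg, ← Real.mul_rpow (by norm_num) hz.le]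
    exact Real.rpow_le_rpow hx.le h2 hg
  · rw [abs_of_nonpos hg, Real.rpow_neg (by norm_num), ← Real.inv_rpow (by norm_num),
      ← Real.mul_rpow (by norm_num) hz.le]
    exact Real.rpow_le_rpow_of_nonpos (by positivity) (by linarith) hg

/-- The unit cube. -/
abbrev auxB (d : ℕ) : Set (Fin d → ℝ) := Metric.closedBall 0 (1 / 2)

theorem auxB_vol (d : ℕ) : (volume : Measure (Fin d → ℝ)) (auxB d) = 1 := by
  rw [auxB, Real.volume_pi_closedBall _ (by norm_num)]
  norm_num

instance auxB_prob (d : ℕ) :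
    IsProbabilityMeasure ((volume : Measure (Fin d → ℝ)).restrict (auxB d)) :=
  ⟨by rw [Measure.restrict_apply_univ, auxB_vol]⟩

theorem auxB_int {d : ℕ} {h : (Fin d → ℝ) → ℝ} (hc : Continuous h) :
    IntegrableOn h (auxB d) :=
  hc.continuousOn.integrableOn_compact (isCompact_closedBall _ _)

theorem aux_holder {d : ℕ} (p : ℝ) (hp : 1 < p) (h : (Fin d → ℝ) → ℝ) (hc : Continuous h)
    (h0 : ∀ y, 0 ≤ h y) :
    ∫ y in auxB d, h y ≤ (∫ y in auxB d, h y ^ p) ^ (1 / p) := by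
  have hpq := Real.HolderConjugate.conjExponent hp
  have hb : ∃ C, ∀ y ∈ auxB d, ‖h y‖ ≤ C :=
    (isCompact_closedBall (0 : Fin d → ℝ) (1 / 2)).exists_bound_of_continuousOn hc.continuousOn
  obtain ⟨C, hC⟩ := hb
  have := integral_mul_le_Lp_mul_Lq_of_nonneg (μ := volume.restrict (auxB d)) hpq
    (f := h) (g := fun _ => 1) (Filter.Eventually.of_forall h0)
    (Filter.Eventually.of_forall fun _ => zero_le_one)
    (MemLp.of_bound hc.aestronglyMeasurable C
      ((ae_restrict_iff' measurableSet_closedBall).2 (Filter.Eventually.of_forall hC)))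
    (memLp_const 1)
  simpa using this

theorem aux_term {d : ℕ} (hd : 1 ≤ d) (p : ℝ) (hp : 1 < p) (γ : ℝ) (h : (Fin d → ℝ) → ℝ)
    (hc : Continuous h) (hs : HasCompactSupport h) (x : Fin d → ℝ) (s : ℝ) (s0 : 0 < s)
    (s1 : s ≤ 1) :
    ∫ y in auxB d, |h (x + (s * (jap x / (2 * d))) • y)| ≤
      (2 ^ |γ| * (2 * d) ^ ((d : ℝ) / p)) * s ^ (-((d : ℝ) / p)) * jap x ^ (-(γ + (d : ℝ) / p)) *
        (∫ z : Fin d → ℝ, jap z ^ (γ * p) * |h z| ^ p) ^ (1 / p) := by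
  have hp0 : 0 < p := by linarith
  have hd0 : (0 : ℝ) < d := by exact_mod_cast hd
  set J := jap x with hJ
  have hJ1 : 1 ≤ J := aux_jap_pos x
  have hJ0 : 0 < J := by linarith
  set R := J / (2 * d) with hR
  have hR0 : 0 < R := by positivity
  have hsR : 0 < s * R := by positivity
  set G : (Fin d → ℝ) → ℝ := fun z => jap z ^ (γ * p) * |h z| ^ p with hG
  have hG0 : ∀ z, 0 ≤ G z := fun z =>
    mul_nonneg (Real.rpow_nonneg (by linarith [aux_jap_pos z]) _) (Real.rpow_nonneg (abs_nonneg _) _)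
  have hGc : Continuous G := by
    refine Continuous.mul ?_ ?_
    · exact aux_jap_cont.rpow_const fun z => Or.inl (by linarith [aux_jap_pos z])
    · exact hc.abs.rpow_const fun z => Or.inr hp0.le
  have hGs : HasCompactSupport G := by
    refine hs.mono ?_
    intro z hz hz0
    apply hz
    simp [hG, hz0, Real.zero_rpow hp0.ne']
  have hGi : Integrable G := hGc.integrable_of_hasCompactSupport hGs
  have hGi2 : Integrable (fun y => G (x + (s * R) • y)) :=
    (hGi.comp_add_left x).comp_smul hsR.ne'
  have e1 : ∫ y, G (x + (s * R) • y) = ((s * R) ^ d)⁻¹ * ∫ z, G z := by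
    rw [Measure.integral_comp_smul volume (fun y => G (x + y)), integral_add_left_eq_self]
    simp [abs_of_pos hsR, abs_of_pos s0, abs_of_pos hR0]
  have hca : Continuous fun y : Fin d → ℝ => |h (x + (s * R) • y)| := by fun_prop
  have step : ∫ y in auxB d, |h (x + (s * R) • y)| ^ p ≤
      2 ^ |γ * p| * J ^ (-(γ * p)) * (((s * R) ^ d)⁻¹ * ∫ z, G z) := by
    rw [← e1]
    calc _ ≤ ∫ y in auxB d, 2 ^ |γ * p| * J ^ (-(γ * p)) * G (x + (s * R) • y) := by
          refine setIntegral_mono_on (auxB_int (hca.rpow_const fun _ => Or.inr hp0.le))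
            (hGi2.const_mul _).integrableOn measurableSet_closedBall ?_
          intro y hy
          have hcmp := aux_jap_rpow hd x (x + (s * R) • y) (by
            intro i
            have h1 : |y i| ≤ 1 / 2 := by
              have := norm_le_pi_norm y i
              rw [Metric.mem_closedBall, dist_zero_right] at hy
              exact this.trans hy
            simp only [Pi.add_apply, Pi.smul_apply, smul_eq_mul, add_sub_cancel_left]
            rw [abs_mul, abs_of_pos hsR, ← hJ, ← hR]
            calc s * R * |y i| ≤ 1 * R * 1 := by gcongr; linarith
              _ = R := by ring) (γ * p)
          rw [Real.rpow_neg hJ0.le]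
          have hJp : 0 < J ^ (γ * p) := Real.rpow_pos_of_pos hJ0 _
          have hH : 0 ≤ |h (x + (s * R) • y)| ^ p := Real.rpow_nonneg (abs_nonneg _) _
          rw [← hJ] at hcmp
          simp only [hG]
          calc |h (x + (s * R) • y)| ^ p
              = (J ^ (γ * p))⁻¹ * (J ^ (γ * p) * |h (x + (s * R) • y)| ^ p) := by
                field_simp
            _ ≤ (J ^ (γ * p))⁻¹ * ((2 ^ |γ * p| * jap (x + (s * R) • y) ^ (γ * p))
                * |h (x + (s * R) • y)| ^ p) := by gcongr
            _ = _ := by ring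
      _ = 2 ^ |γ * p| * J ^ (-(γ * p)) * ∫ y in auxB d, G (x + (s * R) • y) :=
          integral_const_mul _ _
      _ ≤ _ := by
          refine mul_le_mul_of_nonneg_left ?_ (by positivity)
          exact setIntegral_le_integral hGi2 (Filter.Eventually.of_forall fun y => hG0 _)
  have hI0 : 0 ≤ ∫ z, G z := integral_nonneg hG0
  refine (aux_holder p hp _ hca fun _ => abs_nonneg _).trans ?_
  refine (Real.rpow_le_rpow (integral_nonneg fun _ => Real.rpow_nonneg (abs_nonneg _) _) step
    (by positivity)).trans (le_of_eq ?_)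
  rw [Real.mul_rpow (by positivity) (by positivity), Real.mul_rpow (by positivity) (by positivity),
    Real.mul_rpow (by positivity) hI0]
  rw [abs_mul, abs_of_pos hp0]
  have f1 : ((2 : ℝ) ^ (|γ| * p)) ^ (1 / p) = 2 ^ |γ| := by
    rw [← Real.rpow_mul (by norm_num)]; congr 1; field_simp
  have f2 : (J ^ (-(γ * p))) ^ (1 / p) = J ^ (-γ) := by
    rw [← Real.rpow_mul hJ0.le]; congr 1; field_simp
  have f3 : (((s * R) ^ d)⁻¹) ^ (1 / p)
      = s ^ (-((d : ℝ) / p)) * J ^ (-((d : ℝ) / p)) * (2 * d) ^ ((d : ℝ) / p) := by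
    rw [← Real.rpow_natCast, ← Real.rpow_neg hsR.le, ← Real.rpow_mul hsR.le,
      show -(d : ℝ) * (1 / p) = -((d : ℝ) / p) by ring,
      Real.mul_rpow s0.le hR0.le, hR, Real.div_rpow hJ0.le (by positivity),
      Real.rpow_neg (x := 2 * (d : ℝ)) (by positivity), div_inv_eq_mul, mul_assoc]
  rw [f1, f2, f3, neg_add, Real.rpow_add hJ0]
  ring

theorem aux_M_int {d m : ℕ} (hd : 1 ≤ d) (p : ℝ) (hp : 1 < p) (δ : ℝ) (n : ℕ) (hn : n ≤ m)
    (f : (Fin d → ℝ) → ℝ) (hf : ContDiff ℝ (⊤ : ℕ∞) f) (hs : HasCompactSupport f)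
    (x : Fin d → ℝ) (s : ℝ) (s0 : 0 < s) (s1 : s ≤ 1) :
    ∫ y in auxB d, auxM d m n f (x + (s * (jap x / (2 * d))) • y) ≤
      (2 ^ |δ + n| * (2 * d) ^ ((d : ℝ) / p)) * s ^ (-((d : ℝ) / p)) *
        jap x ^ (-(δ + n + (d : ℝ) / p)) * wnorm d m p δ f := by
  have hJ0 : 0 < jap x := by linarith [aux_jap_pos x]
  unfold auxM wnorm
  rw [integral_finsetSum, Finset.mul_sum]
  · refine Finset.sum_le_sum fun β _ => ?_
    by_cases h : (∑ j, (β j : ℕ)) = n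
    · have hn' : (∑ j, (β j : ℕ)) ≤ m := h ▸ hn
      simp only [h, if_true, hn]
      have hcast : (∑ j, ((β j : ℕ) : ℝ)) = n := by rw [← h]; push_cast; rfl
      rw [hcast]
      exact aux_term hd p hp (δ + n) _ (aux_pdm_smooth _ hf).continuous (aux_pdm_supp _ hs) x s
        s0 s1
    · simp only [h, if_false, integral_zero]
      refine mul_nonneg (by positivity) ?_
      split_ifs
      · refine Real.rpow_nonneg (integral_nonneg fun z => ?_) _
        exact mul_nonneg (Real.rpow_nonneg (by linarith [aux_jap_pos z]) _)
          (Real.rpow_nonneg (abs_nonneg _) _)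
      · exact le_rfl
  · intro β _
    split_ifs
    · refine auxB_int ?_
      have := (aux_pdm_smooth (fun j => (β j : ℕ)) hf).continuous
      fun_prop
    · simp

theorem aux_wnorm_nonneg {d m : ℕ} (p δ : ℝ) (f : (Fin d → ℝ) → ℝ) : 0 ≤ wnorm d m p δ f := by
  unfold wnorm
  refine Finset.sum_nonneg fun β _ => ?_
  split_ifs
  · refine Real.rpow_nonneg (integral_nonneg fun z => ?_) _
    exact mul_nonneg (Real.rpow_nonneg (by linarith [aux_jap_pos z]) _)
      (Real.rpow_nonneg (abs_nonneg _) _)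
  · exact le_rfl

theorem aux_point {d m k : ℕ} (hd : 1 ≤ d) (α : Fin d → ℕ) (hk : (∑ j, α j) + (k + 1) = m)
    (f : (Fin d → ℝ) → ℝ) (hf : ContDiff ℝ (⊤ : ℕ∞) f) (x y : Fin d → ℝ) (hy : y ∈ auxB d) :
    |pdm α f x| ≤ ∑ j ∈ Finset.range (k + 1), jap x ^ j *
        auxM d m ((∑ i, α i) + j) f (x + ((1 : ℝ) * (jap x / (2 * d))) • y)
      + ∫ s in Set.Ioc (0 : ℝ) 1, jap x ^ (k + 1) *
          (s ^ k * auxM d m m f (x + (s * (jap x / (2 * d))) • y)) := by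
  have hd0 : (0 : ℝ) < d := by exact_mod_cast hd
  have hJ0 : 0 < jap x := by linarith [aux_jap_pos x]
  set R := jap x / (2 * d) with hR
  have hR0 : 0 < R := by positivity
  set w : Fin d → ℝ := R • y with hw
  have hwR : ∀ i, |w i| ≤ R := by
    intro i
    have h1 : |y i| ≤ 1 / 2 := by
      have := norm_le_pi_norm y i
      rw [Metric.mem_closedBall, dist_zero_right] at hy
      exact this.trans hy
    simp only [hw, Pi.smul_apply, smul_eq_mul, abs_mul, abs_of_pos hR0]
    nlinarith
  have hg := aux_pdm_smooth α hf
  have hT := aux_taylor (fun j s => (auxT w)^[j] (pdm α f) (x + s • w)) (by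
    intro j s
    have h1 : HasFDerivAt ((auxT w)^[j] (pdm α f))
        (fderiv ℝ ((auxT w)^[j] (pdm α f)) (x + s • w)) (x + s • w) :=
      ((auxT_it_smooth w j hg).differentiable (by simp) _).hasFDerivAt
    have h2 : HasDerivAt (fun s : ℝ => x + s • w) w s := by
      simpa using ((hasDerivAt_id s).smul_const w).const_add x
    have h3 := h1.comp_hasDerivAt s h2
    rw [Function.iterate_succ_apply']
    exact h3) k
  have hdR : (d : ℝ) * R ≤ jap x := by
    rw [hR]; field_simp; linarith
  have hb : ∀ j, (∑ i, α i) + j ≤ m → ∀ z, |(auxT w)^[j] (pdm α f) z| ≤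
      jap x ^ j * auxM d m ((∑ i, α i) + j) f z := by
    intro j hj z
    refine (auxT_bound w R hwR hf j hR0.le z α hj).trans ?_
    exact mul_le_mul_of_nonneg_right (pow_le_pow_left₀ (by positivity) hdR j) (auxM_nonneg f z)
  simp only [Function.iterate_zero, id, zero_smul, add_zero] at hT
  refine hT.trans ?_
  have hsw : ∀ s : ℝ, s • w = (s * R) • y := fun s => by rw [hw, smul_smul]
  refine add_le_add ?_ ?_
  · refine Finset.sum_le_sum fun j hj => ?_
    rw [hsw]
    exact hb j (by have := Finset.mem_range.1 hj; omega) _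
  · rw [← intervalIntegral.integral_of_le (by norm_num)]
    have hMc : Continuous (auxM d m m f) := auxM_cont hf
    have hTc := (auxT_it_smooth w (k + 1) hg).continuous
    refine intervalIntegral.integral_mono_on (by norm_num) ?_ ?_ ?_
    · refine Continuous.intervalIntegrable ?_ _ _
      fun_prop
    · refine Continuous.intervalIntegrable ?_ _ _
      fun_prop
    · intro s hs
      have := hb (k + 1) hk.le (x + s • w)
      rw [hk, hsw] at this
      rw [hsw]
      have hsk : 0 ≤ s ^ k := pow_nonneg hs.1 k
      calc _ ≤ s ^ k * _ := mul_le_mul_of_nonneg_left this hsk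
        _ = _ := by ring

theorem aux_fub {d m k : ℕ} (f : (Fin d → ℝ) → ℝ) (hf : ContDiff ℝ (⊤ : ℕ∞) f)
    (x : Fin d → ℝ) (R A : ℝ) :
    Integrable (Function.uncurry fun (s : ℝ) (y : Fin d → ℝ) =>
      A * (s ^ k * auxM d m m f (x + (s * R) • y)))
      ((volume.restrict (Set.Ioc (0 : ℝ) 1)).prod (volume.restrict (auxB d))) := by
  rw [Measure.prod_restrict]
  have hMc : Continuous (auxM d m m f) := auxM_cont hf
  have hc : Continuous (Function.uncurry fun (s : ℝ) (y : Fin d → ℝ) =>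
      A * (s ^ k * auxM d m m f (x + (s * R) • y))) := by
    unfold Function.uncurry
    fun_prop
  have : IntegrableOn (Function.uncurry fun (s : ℝ) (y : Fin d → ℝ) =>
      A * (s ^ k * auxM d m m f (x + (s * R) • y))) (Set.Icc (0 : ℝ) 1 ×ˢ auxB d)
      ((volume : Measure ℝ).prod (volume : Measure (Fin d → ℝ))) :=
    hc.continuousOn.integrableOn_compact (isCompact_Icc.prod (isCompact_closedBall _ _))
  exact this.mono_set (Set.prod_mono Set.Ioc_subset_Icc_self subset_rfl)

theorem aux_main {d m k : ℕ} (hd : 1 ≤ d) (p : ℝ) (hp : 1 < p) (δ : ℝ)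
    (α : Fin d → ℕ) (hk : (∑ j, α j) + (k + 1) = m) (hkp : (d : ℝ) / p < k + 1)
    (f : (Fin d → ℝ) → ℝ) (hf : ContDiff ℝ (⊤ : ℕ∞) f) (hs : HasCompactSupport f)
    (x : Fin d → ℝ) :
    |pdm α f x| ≤
      (∑ j ∈ Finset.range (k + 1),
        (2 : ℝ) ^ |δ + (((∑ i, α i) + j : ℕ) : ℝ)| * (2 * (d : ℝ)) ^ ((d : ℝ) / p)
        + (2 : ℝ) ^ |δ + m| * (2 * (d : ℝ)) ^ ((d : ℝ) / p) * (1 / (k + 1 - (d : ℝ) / p))) *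
      (jap x ^ (-(δ + (d : ℝ) / p + ((∑ j, α j : ℕ) : ℝ))) * wnorm d m p δ f) := by
  have hJ0 : 0 < jap x := by linarith [aux_jap_pos x]
  have hMc : ∀ n, Continuous (auxM d m n f) := fun n => auxM_cont hf
  set R := jap x / (2 * d) with hR
  set E := δ + (d : ℝ) / p + ((∑ j, α j : ℕ) : ℝ) with hE
  have hJ : ∀ j : ℕ, jap x ^ j * jap x ^ (-(δ + (((∑ i, α i) + j : ℕ) : ℝ) + (d : ℝ) / p))
      = jap x ^ (-E) := by
    intro j
    rw [← Real.rpow_natCast, ← Real.rpow_add hJ0]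
    congr 1
    rw [hE]; push_cast; ring
  have hF := aux_fub (d := d) (m := m) (k := k) f hf x R (jap x ^ (k + 1))
  have hI1 : ∀ j, IntegrableOn (fun y => jap x ^ j *
        auxM d m ((∑ i, α i) + j) f (x + ((1 : ℝ) * R) • y)) (auxB d) := by
    intro j
    refine auxB_int ?_
    have := hMc ((∑ i, α i) + j)
    fun_prop
  have hI2 : IntegrableOn (fun y => ∫ s in Set.Ioc (0 : ℝ) 1, jap x ^ (k + 1) *
          (s ^ k * auxM d m m f (x + (s * R) • y))) (auxB d) := hF.integral_prod_right
  have h1 : |pdm α f x| ≤ ∫ y in auxB d, (∑ j ∈ Finset.range (k + 1), jap x ^ j *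
        auxM d m ((∑ i, α i) + j) f (x + ((1 : ℝ) * R) • y)
      + ∫ s in Set.Ioc (0 : ℝ) 1, jap x ^ (k + 1) *
          (s ^ k * auxM d m m f (x + (s * R) • y))) := by
    have : ∫ y in auxB d, |pdm α f x| = |pdm α f x| := by simp
    rw [← this]
    refine setIntegral_mono_on (integrable_const _)
      ((integrable_finsetSum _ fun j _ => hI1 j).add hI2) measurableSet_closedBall ?_
    intro y hy
    exact aux_point hd α hk f hf x y hy
  refine h1.trans ?_
  rw [integral_add (integrable_finsetSum _ fun j _ => hI1 j) hI2,
    integral_finsetSum _ fun j _ => hI1 j, add_mul, Finset.sum_mul]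
  refine add_le_add ?_ ?_
  · refine Finset.sum_le_sum fun j hj => ?_
    rw [integral_const_mul]
    have hjm : (∑ i, α i) + j ≤ m := by have := Finset.mem_range.1 hj; omega
    have := aux_M_int hd p hp δ ((∑ i, α i) + j) hjm f hf hs x 1 one_pos le_rfl
    rw [Real.one_rpow, mul_one] at this
    calc _ ≤ jap x ^ j * _ := mul_le_mul_of_nonneg_left this (by positivity)
      _ = _ := by rw [← hJ j]; ring
  · rw [← integral_integral_swap hF]
    set K : ℝ := 2 ^ |δ + m| * (2 * d) ^ ((d : ℝ) / p) with hK
    have hr : (-1 : ℝ) < k - (d : ℝ) / p := by linarith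
    have hint : IntegrableOn (fun s : ℝ => K * (jap x ^ (-E) * wnorm d m p δ f) *
        s ^ ((k : ℝ) - (d : ℝ) / p)) (Set.Ioc 0 1) := by
      refine Integrable.const_mul ?_ _
      exact (intervalIntegrable_iff_integrableOn_Ioc_of_le (by norm_num)).1
        (intervalIntegral.intervalIntegrable_rpow' hr)
    calc _ ≤ ∫ s in Set.Ioc (0 : ℝ) 1, K * (jap x ^ (-E) * wnorm d m p δ f) *
        s ^ ((k : ℝ) - (d : ℝ) / p) := by
          refine setIntegral_mono_on hF.integral_prod_left hint measurableSet_Ioc ?_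
          intro s hs'
          try simp only [Function.uncurry_apply_pair]
          rw [integral_const_mul, integral_const_mul]
          have := aux_M_int hd p hp δ m le_rfl f hf hs x s hs'.1 hs'.2
          have hJk := hJ (k + 1)
          rw [hk] at hJk
          have hsk : 0 ≤ s ^ k := pow_nonneg hs'.1.le k
          calc _ ≤ jap x ^ (k + 1) * (s ^ k * _) :=
                mul_le_mul_of_nonneg_left (mul_le_mul_of_nonneg_left this hsk) (by positivity)
            _ = _ := by
                rw [← hJk, sub_eq_add_neg, Real.rpow_add hs'.1, Real.rpow_natCast]; ring
      _ = _ := by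
          rw [integral_const_mul, ← intervalIntegral.integral_of_le (by norm_num),
            integral_rpow (Or.inl hr), Real.one_rpow, Real.zero_rpow (by linarith)]
          rw [show (k : ℝ) - d / p + 1 = k + 1 - d / p by ring]
          ring

theorem stmt0 (d m : ℕ) (hd : 1 ≤ d) (p : ℝ) (hp : 1 < p) (δ : ℝ)
    (hm : (d : ℝ) / p < m) (α : Fin d → ℕ)
    (hα : ((∑ j, α j : ℕ) : ℝ) < (m : ℝ) - (d : ℝ) / p) :
    ∃ C > 0, ∀ f : (Fin d → ℝ) → ℝ, ContDiff ℝ (⊤ : ℕ∞) f → HasCompactSupport f →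
      ∀ x : Fin d → ℝ,
        jap x ^ (δ + (d : ℝ) / p + ((∑ j, α j : ℕ) : ℝ)) * |pdm α f x| ≤
          C * wnorm d m p δ f := by
  have hd0 : (0 : ℝ) < d := by exact_mod_cast hd
  have hp0 : 0 < p := by linarith
  have hdp : 0 < (d : ℝ) / p := by positivity
  have hlt : (∑ j, α j) < m := by
    have : ((∑ j, α j : ℕ) : ℝ) < m := by linarith
    exact_mod_cast this
  obtain ⟨k, hk⟩ : ∃ k, (∑ j, α j) + (k + 1) = m := ⟨m - (∑ j, α j) - 1, by omega⟩
  have hkp : (d : ℝ) / p < k + 1 := by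
    have : ((∑ j, α j : ℕ) : ℝ) + (k + 1) = m := by exact_mod_cast hk
    linarith
  have hkp' : 0 < (k : ℝ) + 1 - (d : ℝ) / p := by linarith
  refine ⟨(∑ j ∈ Finset.range (k + 1),
        (2 : ℝ) ^ |δ + (((∑ i, α i) + j : ℕ) : ℝ)| * (2 * (d : ℝ)) ^ ((d : ℝ) / p)
        + (2 : ℝ) ^ |δ + m| * (2 * (d : ℝ)) ^ ((d : ℝ) / p) * (1 / (k + 1 - (d : ℝ) / p))), ?_, fun f hf hs x => ?_⟩
  rotate_left
  · have hJ0 : 0 < jap x := by linarith [aux_jap_pos x]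
    have h := aux_main hd p hp δ α hk hkp f hf hs x
    have hJE : 0 < jap x ^ (δ + (d : ℝ) / p + ((∑ j, α j : ℕ) : ℝ)) := Real.rpow_pos_of_pos hJ0 _
    rw [Real.rpow_neg hJ0.le] at h
    refine (mul_le_mul_of_nonneg_left h hJE.le).trans (le_of_eq ?_)
    rw [mul_left_comm, mul_inv_cancel_left₀ hJE.ne']
  · positivity
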